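/- For every α ∈ (1, 2] and all random variables (X_1, …, X_k) taking values in finite sets, the Φ-ribbons for φ_α and Φ_α coincide: 𝓡_{φ_α}(X_1, …, X_k) = 𝓡_{Φ_α}(X_1, …, X_k), where φ_α(t) = t^α on [0, ∞) and Φ_α(t) = ((1+t)^α + (1−t)^α − 2)/(2^α − 2) on [−1, 1]. -/

import Mathlib

open Finset

noncomputable section

/-- A probability mass function on a finite type. -/
def IsPMF {Ω : Type*} [Fintype Ω] (p : Ω → ℝ) : Prop :=
  (∀ ω, 0 ≤ p ω) ∧ ∑ ω, p ω = 1

/-- Expectation of `f` under the pmf `p`. -/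
def expect {Ω : Type*} [Fintype Ω] (p : Ω → ℝ) (f : Ω → ℝ) : ℝ :=
  ∑ ω, p ω * f ω

/-- Variance of `f` under the pmf `p`. -/
def var {Ω : Type*} [Fintype Ω] (p : Ω → ℝ) (f : Ω → ℝ) : ℝ :=
  ∑ ω, p ω * (f ω - expect p f) ^ 2

open scoped Classical in
/-- Conditional expectation `E[f | X]`, as a function on the sample space. -/
def condExp {Ω β : Type*} [Fintype Ω] (p : Ω → ℝ) (f : Ω → ℝ) (X : Ω → β) : Ω → ℝ :=
  fun ω => (∑ ω', if X ω' = X ω then p ω' * f ω' else 0) /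
    (∑ ω', if X ω' = X ω then p ω' else 0)

/-- The Φ-entropy `H_Φ(f) = E[Φ(f)] - Φ(E[f])`. -/
def Hphi {Ω : Type*} [Fintype Ω] (Φ : ℝ → ℝ) (p : Ω → ℝ) (f : Ω → ℝ) : ℝ :=
  expect p (fun ω => Φ (f ω)) - Φ (expect p f)

/-- The conditional Φ-entropy `H_Φ(f | X) = E[Φ(f)] - E[Φ(E[f|X])]`. -/
def HphiCond {Ω β : Type*} [Fintype Ω] (Φ : ℝ → ℝ) (p : Ω → ℝ) (f : Ω → ℝ) (X : Ω → β) : ℝ :=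
  expect p (fun ω => Φ (f ω)) - expect p (fun ω => Φ (condExp p f X ω))

/-- The class 𝓕 of smooth convex non-affine functions `Φ` on a convex domain `D ⊆ ℝ`
such that for every `q ∈ [0,1]` the map
`(s,t) ↦ q Φ(s) + (1-q) Φ(t) - Φ(q s + (1-q) t)` is jointly convex. -/
structure ClassF where
  D : Set ℝ
  Φ : ℝ → ℝ
  convex_dom : Convex ℝ D
  smooth : ContDiffOn ℝ (⊤ : ℕ∞) Φ D
  convexOn : ConvexOn ℝ D Φ
  not_affine : ¬ ∃ a b : ℝ, ∀ t ∈ D, Φ t = a * t + b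
  joint_convex : ∀ q ∈ Set.Icc (0:ℝ) 1,
    ConvexOn ℝ (D ×ˢ D)
      (fun st : ℝ × ℝ => q * Φ st.1 + (1 - q) * Φ st.2 - Φ (q * st.1 + (1 - q) * st.2))

/-- The Φ-ribbon of `k` random variables with joint pmf `p` (the `i`-th variable being the
`i`-th coordinate): all tuples `λ` of non-negative reals such that
`H_Φ(f) ≥ Σ_i λ_i H_Φ(E[f | X_i])` for every `f` with range in `D`. -/
def ribbon {k : ℕ} {α : Fin k → Type} [∀ i, Fintype (α i)]
    (Φ : ℝ → ℝ) (D : Set ℝ) (p : (∀ i, α i) → ℝ) : Set (Fin k → ℝ) :=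
  {l | (∀ i, 0 ≤ l i) ∧ ∀ f : (∀ i, α i) → ℝ, (∀ ω, f ω ∈ D) →
    Hphi Φ p f ≥ ∑ i, l i * Hphi Φ p (condExp p f (fun ω => ω i))}
section Ribbon

variable {Ω β : Type*} [Fintype Ω] {p : Ω → ℝ}

theorem expect_affine (hp : IsPMF p) (c d : ℝ) (f : Ω → ℝ) :
    expect p (fun ω => c + d * f ω) = c + d * expect p f := by
  have h : ∀ ω, p ω * (c + d * f ω) = c * p ω + d * (p ω * f ω) := fun ω => by ring
  simp only [_root_.expect, h, sum_add_distrib, ← mul_sum, hp.2, mul_one]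

theorem expect_congr {f g : Ω → ℝ} (h : ∀ ω, p ω ≠ 0 → f ω = g ω) :
    expect p f = expect p g := by
  refine sum_congr rfl fun ω _ => ?_
  by_cases hω : p ω = 0
  · simp [hω]
  · rw [h ω hω]

theorem expect_mono (hp : IsPMF p) {f g : Ω → ℝ} (h : ∀ ω, f ω ≤ g ω) :
    expect p f ≤ expect p g :=
  sum_le_sum fun ω _ => mul_le_mul_of_nonneg_left (h ω) (hp.1 ω)

theorem expect_nonneg (hp : IsPMF p) {f : Ω → ℝ} (h : ∀ ω, 0 ≤ f ω) : 0 ≤ expect p f :=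
  sum_nonneg fun ω _ => mul_nonneg (hp.1 ω) (h ω)

theorem Hphi_congr (Φ : ℝ → ℝ) {f g : Ω → ℝ} (h : ∀ ω, p ω ≠ 0 → f ω = g ω) :
    Hphi Φ p f = Hphi Φ p g := by
  rw [Hphi, Hphi, expect_congr h, expect_congr (f := fun ω => Φ (f ω)) fun ω hω => by rw [h ω hω]]

theorem Hphi_nonneg (hp : IsPMF p) {Φ : ℝ → ℝ} {D : Set ℝ} (hΦ : ConvexOn ℝ D Φ)
    {f : Ω → ℝ} (hf : ∀ ω, f ω ∈ D) : 0 ≤ Hphi Φ p f := by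
  have h := hΦ.map_sum_le (t := univ) (w := p) (p := f) (fun ω _ => hp.1 ω) hp.2 fun ω _ => hf ω
  simpa [Hphi, _root_.expect] using h

theorem condExp_affine (hp : IsPMF p) (X : Ω → β) (c d : ℝ) (f : Ω → ℝ) {ω : Ω} (hω : p ω ≠ 0) :
    condExp p (fun ω => c + d * f ω) X ω = c + d * condExp p f X ω := by
  classical
  have hmass : 0 < ∑ ω', if X ω' = X ω then p ω' else 0 := by
    refine sum_pos' (fun ω' _ => ?_) ⟨ω, mem_univ ω, ?_⟩
    · split_ifs
      exacts [hp.1 ω', le_rfl]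
    · simpa using (hp.1 ω).lt_of_ne' hω
  have hnum : (∑ ω', if X ω' = X ω then p ω' * (c + d * f ω') else 0)
      = c * (∑ ω', if X ω' = X ω then p ω' else 0)
        + d * ∑ ω', if X ω' = X ω then p ω' * f ω' else 0 := by
    rw [mul_sum, mul_sum, ← sum_add_distrib]
    refine sum_congr rfl fun ω' _ => ?_
    split_ifs <;> ring
  simp only [condExp]
  have hmass' := hmass.ne'
  convert_to (∑ ω', if X ω' = X ω then p ω' * (c + d * f ω') else 0) /
      (∑ ω', if X ω' = X ω then p ω' else 0) = c + d *
      ((∑ ω', if X ω' = X ω then p ω' * f ω' else 0) / (∑ ω', if X ω' = X ω then p ω' else 0))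
  rw [hnum]
  field_simp

theorem condExp_nonneg (hp : IsPMF p) (X : Ω → β) {f : Ω → ℝ} (hf : ∀ ω, 0 ≤ f ω) (ω : Ω) :
    0 ≤ condExp p f X ω := by
  refine div_nonneg (sum_nonneg fun ω' _ => ?_) (sum_nonneg fun ω' _ => ?_) <;> split_ifs
  exacts [mul_nonneg (hp.1 ω') (hf ω'), le_rfl, hp.1 ω', le_rfl]

/-- The gap `H_Φ(f) - Σ_i λ_i H_Φ(E[f | X_i])` in the inequality defining the Φ-ribbon. -/
def ribbonGap {k : ℕ} {B : Fin k → Type*} (Φ : ℝ → ℝ) (p : Ω → ℝ) (X : ∀ i, Ω → B i)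
    (l : Fin k → ℝ) (f : Ω → ℝ) : ℝ :=
  Hphi Φ p f - ∑ i, l i * Hphi Φ p (condExp p f (X i))

section Gap

variable {k : ℕ} {B : Fin k → Type*} {X : ∀ i, Ω → B i} {l : Fin k → ℝ} {a : ℝ}

theorem Hphi_symm_rpow (hp : IsPMF p) (a b : ℝ) (f : Ω → ℝ) :
    Hphi (fun t : ℝ => ((1 + t) ^ a + (1 - t) ^ a - 2) / b) p f
      = (Hphi (fun t : ℝ => t ^ a) p (fun ω => 1 + 1 * f ω)
        + Hphi (fun t : ℝ => t ^ a) p (fun ω => 1 + (-1) * f ω)) / b := by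
  simp only [Hphi, expect_affine hp]
  have h : expect p (fun ω => ((1 + f ω) ^ a + (1 - f ω) ^ a - 2) / b)
      = (expect p (fun ω => (1 + f ω) ^ a) + expect p (fun ω => (1 - f ω) ^ a) - 2) / b := by
    have h2 : (2 : ℝ) = ∑ ω, p ω * 2 := by rw [← sum_mul, hp.2, one_mul]
    conv_rhs => rw [h2]
    simp only [_root_.expect]
    rw [← sum_add_distrib, ← sum_sub_distrib, sum_div]
    exact sum_congr rfl fun ω _ => by ring
  rw [h]
  simp only [one_mul, neg_one_mul, ← sub_eq_add_neg]
  ring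

theorem Hphi_condExp_affine (hp : IsPMF p) (Φ : ℝ → ℝ) (X : Ω → β) (c d : ℝ) (f : Ω → ℝ) :
    Hphi Φ p (condExp p (fun ω => c + d * f ω) X)
      = Hphi Φ p (fun ω => c + d * condExp p f X ω) :=
  Hphi_congr Φ fun _ hω => condExp_affine hp X c d f hω

theorem ribbonGap_symm_rpow (hp : IsPMF p) (a b : ℝ) (f : Ω → ℝ) :
    ribbonGap (fun t : ℝ => ((1 + t) ^ a + (1 - t) ^ a - 2) / b) p X l f
      = (ribbonGap (fun t : ℝ => t ^ a) p X l (fun ω => 1 + 1 * f ω)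
        + ribbonGap (fun t : ℝ => t ^ a) p X l (fun ω => 1 + (-1) * f ω)) / b := by
  simp only [ribbonGap, Hphi_condExp_affine hp, Hphi_symm_rpow hp]
  have h : ∀ u v s t : ℝ, (u - s + (v - t)) / b = (u + v) / b - (s + t) / b :=
    fun u v s t => by ring
  rw [h, ← sum_add_distrib, sum_div]
  congr 1
  exact sum_congr rfl fun i _ => by ring

theorem Hphi_rpow_mul (hp : IsPMF p) {ε : ℝ} (hε : 0 ≤ ε) {f : Ω → ℝ} (hf : ∀ ω, 0 ≤ f ω) :
    Hphi (fun t : ℝ => t ^ a) p (fun ω => 0 + ε * f ω)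
      = ε ^ a * Hphi (fun t : ℝ => t ^ a) p f := by
  simp only [Hphi, expect_affine hp]
  simp only [zero_add]
  rw [Real.mul_rpow hε (expect_nonneg hp hf), mul_sub]
  congr 1
  rw [_root_.expect, _root_.expect, mul_sum]
  exact sum_congr rfl fun ω _ => by rw [Real.mul_rpow hε (hf ω)]; ring

theorem ribbonGap_rpow_mul (hp : IsPMF p) {ε : ℝ} (hε : 0 ≤ ε) {f : Ω → ℝ} (hf : ∀ ω, 0 ≤ f ω) :
    ribbonGap (fun t : ℝ => t ^ a) p X l (fun ω => 0 + ε * f ω)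
      = ε ^ a * ribbonGap (fun t : ℝ => t ^ a) p X l f := by
  simp only [ribbonGap, Hphi_condExp_affine hp, Hphi_rpow_mul hp hε hf,
    Hphi_rpow_mul hp hε (condExp_nonneg hp _ hf)]
  rw [mul_sub, mul_sum]
  congr 1
  exact sum_congr rfl fun i _ => by ring

theorem Hphi_rpow_two_affine (hp : IsPMF p) (c d : ℝ) (f : Ω → ℝ) :
    Hphi (fun t : ℝ => t ^ (2 : ℝ)) p (fun ω => c + d * f ω)
      = d ^ 2 * Hphi (fun t : ℝ => t ^ (2 : ℝ)) p f := by
  simp only [Hphi, expect_affine hp, Real.rpow_two]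
  have h : expect p (fun ω => (c + d * f ω) ^ 2)
      = c ^ 2 + 2 * c * d * expect p f + d ^ 2 * expect p (fun ω => f ω ^ 2) := by
    have h2 : c ^ 2 = ∑ ω, p ω * c ^ 2 := by rw [← sum_mul, hp.2, one_mul]
    rw [h2]
    simp only [_root_.expect]
    rw [mul_sum, mul_sum, ← sum_add_distrib, ← sum_add_distrib]
    exact sum_congr rfl fun ω _ => by ring
  rw [h]
  ring

theorem ribbonGap_rpow_two_affine (hp : IsPMF p) (c d : ℝ) (f : Ω → ℝ) :
    ribbonGap (fun t : ℝ => t ^ (2 : ℝ)) p X l (fun ω => c + d * f ω)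
      = d ^ 2 * ribbonGap (fun t : ℝ => t ^ (2 : ℝ)) p X l f := by
  simp only [ribbonGap, Hphi_condExp_affine hp, Hphi_rpow_two_affine hp]
  rw [mul_sub, mul_sum]
  congr 1
  exact sum_congr rfl fun i _ => by ring

theorem one_sub_rpow_le (ha1 : 1 < a) (ha2 : a ≤ 2) {v : ℝ} (hv : v ≤ 1) :
    (1 - v) ^ a ≤ 1 - a * v + (a - 1) * v ^ 2 := by
  rcases hv.eq_or_lt with rfl | hv
  · rw [sub_self, Real.zero_rpow (by linarith)]
    linarith
  have h := rpow_one_add_le_one_add_mul_self (s := -v) (by linarith) (p := a - 1)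
    (by linarith) (by linarith)
  rw [← sub_eq_add_neg] at h
  have h1 : (1 - v) ^ a = (1 - v) * (1 - v) ^ (a - 1) := by
    rw [← Real.rpow_one_add' (by linarith) (by linarith)]
    congr 1
    ring
  rw [h1]
  nlinarith

/-- Near the point `2`, where `t ^ a` is smooth, the entropy is of second order. -/
theorem Hphi_two_sub_le (hp : IsPMF p) (ha1 : 1 < a) (ha2 : a ≤ 2) {ε : ℝ} {f : Ω → ℝ}
    (hf : ∀ ω, ε * f ω ≤ 2) :
    Hphi (fun t : ℝ => t ^ a) p (fun ω => 2 + (-ε) * f ω)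
      ≤ ε ^ 2 * (2 ^ a * (a - 1) / 4 * expect p (fun ω => f ω ^ 2)) := by
  have hscale : ∀ u : ℝ, u ≤ 2 → (2 - u) ^ a = 2 ^ a * (1 - u / 2) ^ a := fun u hu => by
    rw [← Real.mul_rpow (by norm_num) (by linarith)]
    congr 1
    ring
  have h2a : (0 : ℝ) < 2 ^ a := by positivity
  have hup : expect p (fun ω => (2 + (-ε) * f ω) ^ a)
      ≤ 2 ^ a + (-(2 ^ a * a / 2 * ε) * expect p f
        + ε ^ 2 * (2 ^ a * (a - 1) / 4 * expect p (fun ω => f ω ^ 2))) := by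
    have hpt : ∀ ω, (2 + (-ε) * f ω) ^ a
        ≤ 2 ^ a + 1 * (-(2 ^ a * a / 2 * ε) * f ω
          + ε ^ 2 * (2 ^ a * (a - 1) / 4 * f ω ^ 2)) := fun ω => by
      have hb := one_sub_rpow_le ha1 ha2 (v := ε * f ω / 2) (by linarith [hf ω])
      have := mul_le_mul_of_nonneg_left hb h2a.le
      rw [neg_mul, ← sub_eq_add_neg, hscale _ (hf ω)]
      refine this.trans_eq (by ring)
    refine (expect_mono hp hpt).trans_eq ?_
    rw [expect_affine hp, one_mul]
    congr 1
    simp only [_root_.expect]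
    rw [mul_sum, mul_sum, mul_sum, ← sum_add_distrib]
    exact sum_congr rfl fun ω _ => by ring
  have hmean : ε * expect p f ≤ 2 := by
    have h := expect_mono hp (f := fun ω => 0 + ε * f ω) (g := fun ω => 2 + 0 * f ω)
      fun ω => by linarith [hf ω]
    rw [expect_affine hp, expect_affine hp] at h
    linarith
  have hlow : 2 ^ a + -(2 ^ a * a / 2 * ε) * expect p f ≤ (2 + (-ε) * expect p f) ^ a := by
    have hb := one_add_mul_self_le_rpow_one_add (s := -(ε * expect p f / 2)) (by linarith) ha1.le
    rw [← sub_eq_add_neg] at hb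
    have := mul_le_mul_of_nonneg_left hb h2a.le
    rw [neg_mul ε, ← sub_eq_add_neg, hscale _ hmean]
    refine le_trans (le_of_eq (by ring)) this
  simp only [Hphi, expect_affine hp]
  linarith

theorem ribbonGap_two_sub_le (hp : IsPMF p) (ha1 : 1 < a) (ha2 : a ≤ 2) (hl : ∀ i, 0 ≤ l i)
    {ε : ℝ} {f : Ω → ℝ} (hf : ∀ ω, ε * f ω ≤ 2) :
    ribbonGap (fun t : ℝ => t ^ a) p X l (fun ω => 2 + (-ε) * f ω)
      ≤ ε ^ 2 * (2 ^ a * (a - 1) / 4 * expect p (fun ω => f ω ^ 2)) := by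
  refine le_trans (sub_le_self _ (sum_nonneg fun i _ => mul_nonneg (hl i) ?_))
    (Hphi_two_sub_le hp ha1 ha2 hf)
  exact Hphi_nonneg hp (convexOn_rpow ha1.le)
    (condExp_nonneg hp _ fun ω => by linarith [hf ω])

theorem ribbonGap_rpow_nonneg_of_symm (hp : IsPMF p) (ha1 : 1 < a) (ha2 : a ≤ 2)
    (hl : ∀ i, 0 ≤ l i)
    (h : ∀ f : Ω → ℝ, (∀ ω, f ω ∈ Set.Icc (-1 : ℝ) 1) →
      0 ≤ ribbonGap (fun t : ℝ => t ^ a) p X l (fun ω => 1 + 1 * f ω)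
        + ribbonGap (fun t : ℝ => t ^ a) p X l (fun ω => 1 + (-1) * f ω))
    {f : Ω → ℝ} (hf : ∀ ω, 0 ≤ f ω) : 0 ≤ ribbonGap (fun t : ℝ => t ^ a) p X l f := by
  obtain ⟨M, hM0, hM⟩ : ∃ M : ℝ, 0 < M ∧ ∀ ω, f ω ≤ M :=
    ⟨1 + ∑ ω, f ω, by linarith [sum_nonneg fun ω (_ : ω ∈ univ) => hf ω], fun ω => by
      linarith [single_le_sum (fun ω _ => hf ω) (mem_univ ω)]⟩
  have key : ∀ ε : ℝ, 0 < ε → ε ≤ 2 / M → (∀ ω, ε * f ω ≤ 2) ∧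
      0 ≤ ε ^ a * ribbonGap (fun t : ℝ => t ^ a) p X l f
        + ribbonGap (fun t : ℝ => t ^ a) p X l (fun ω => 2 + (-ε) * f ω) := fun ε hε hεM => by
    have hle : ∀ ω, ε * f ω ≤ 2 := fun ω =>
      (mul_le_mul_of_nonneg_left (hM ω) hε.le).trans ((le_div_iff₀ hM0).1 hεM)
    refine ⟨hle, ?_⟩
    have := h (fun ω => -1 + ε * f ω) fun ω =>
      ⟨by linarith [mul_nonneg hε.le (hf ω)], by linarith [hle ω]⟩
    rw [← ribbonGap_rpow_mul hp hε.le hf]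
    convert this using 4 <;> ring
  rcases ha2.eq_or_lt with rfl | ha2'
  · have h0 := (key (2 / M) (by positivity) le_rfl).2
    rw [ribbonGap_rpow_two_affine hp, Real.rpow_two, neg_sq, ← two_mul] at h0
    have : (0 : ℝ) < (2 / M) ^ 2 := by positivity
    exact nonneg_of_mul_nonneg_right (by linarith) this
  set C := 2 ^ a * (a - 1) / 4 * expect p (fun ω => f ω ^ 2)
  have hbound : ∀ᶠ ε in nhdsWithin (0 : ℝ) (Set.Ioi 0),
      -(ε ^ (2 - a) * C) ≤ ribbonGap (fun t : ℝ => t ^ a) p X l f := by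
    filter_upwards [Ioc_mem_nhdsGT (show (0 : ℝ) < 2 / M by positivity)] with ε hε
    obtain ⟨hle, h0⟩ := key ε hε.1 hε.2
    have h1 : ribbonGap (fun t : ℝ => t ^ a) p X l (fun ω => 2 + (-ε) * f ω) ≤ ε ^ 2 * C :=
      ribbonGap_two_sub_le hp ha1 ha2 hl hle
    have hpow : ε ^ 2 = ε ^ a * ε ^ (2 - a) := by
      rw [← Real.rpow_add hε.1, add_sub_cancel, Real.rpow_two]
    rw [hpow, mul_assoc] at h1
    have h2 : 0 ≤ ε ^ a * (ribbonGap (fun t : ℝ => t ^ a) p X l f + ε ^ (2 - a) * C) := by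
      rw [mul_add]
      linarith
    linarith [nonneg_of_mul_nonneg_right h2 (Real.rpow_pos_of_pos hε.1 a)]
  have hlim : Filter.Tendsto (fun ε : ℝ => -(ε ^ (2 - a) * C)) (nhdsWithin 0 (Set.Ioi 0))
      (nhds 0) := by
    have hc : Continuous fun ε : ℝ => -(ε ^ (2 - a) * C) :=
      ((Real.continuous_rpow_const (by linarith)).mul continuous_const).neg
    have := (hc.tendsto 0).mono_left (nhdsWithin_le_nhds (s := Set.Ioi 0))
    simpa [Real.zero_rpow (show 2 - a ≠ 0 by linarith)] using this
  exact le_of_tendsto hlim hbound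

end Gap

end Ribbon

/-- For every `α ∈ (1,2]`, the ribbons of `φ_α(t) = t^α` (on `[0,∞)`) and of
`Φ_α(t) = ((1+t)^α + (1-t)^α − 2)/(2^α − 2)` (on `[−1,1]`) coincide. -/
theorem ribbon_phi_alpha_eq
    {k : ℕ} {α : Fin k → Type} [∀ i, Fintype (α i)]
    (p : (∀ i, α i) → ℝ) (hp : IsPMF p)
    (a : ℝ) (ha : a ∈ Set.Ioc (1:ℝ) 2) :
    ribbon (fun t : ℝ => t ^ a) (Set.Ici 0) p
      = ribbon (fun t : ℝ => ((1 + t) ^ a + (1 - t) ^ a - 2) / (2 ^ a - 2))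
          (Set.Icc (-1) 1) p := by
  obtain ⟨ha1, ha2⟩ := ha
  have hb : (0 : ℝ) < 2 ^ a - 2 := by
    have := Real.rpow_lt_rpow_of_exponent_lt (show (1 : ℝ) < 2 by norm_num) ha1
    rw [Real.rpow_one] at this
    linarith
  have hgap : ∀ (Φ : ℝ → ℝ) (l : Fin k → ℝ) (f : (∀ i, α i) → ℝ),
      Hphi Φ p f ≥ ∑ i, l i * Hphi Φ p (condExp p f (fun ω => ω i))
        ↔ 0 ≤ ribbonGap Φ p (fun i ω => ω i) l f := fun Φ l f => sub_nonneg.symm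
  ext l
  simp only [ribbon, Set.mem_ofPred_eq, hgap, ribbonGap_symm_rpow hp]
  refine and_congr_right fun hl => ⟨fun h f hf => ?_, fun h f hf => ?_⟩
  · refine div_nonneg (add_nonneg (h _ fun ω => ?_) (h _ fun ω => ?_)) hb.le
    · exact Set.mem_Ici.2 (by linarith [(hf ω).1])
    · exact Set.mem_Ici.2 (by linarith [(hf ω).2])
  · exact ribbonGap_rpow_nonneg_of_symm hp ha1 ha2 hl
      (fun g hg => by simpa [hb.ne'] using mul_nonneg (h g hg) hb.le) hf

end
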